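/- Let ι be a nonempty finite index type, and for each i ∈ ι let mᵢ ∈ ℝ, vᵢ ∈ ℝ≥0, bᵢ ∈ ℝ, and sᵢ ∈ {-1, 1}. Let μ be the product measure Measure.pi of the Gaussian measures gaussianReal mᵢ vᵢ over i ∈ ι. Then ∫ (∑ i, Real.log (1 + Real.exp (-sᵢ * (xᵢ + bᵢ)))) ∂μ ≤ ∑ i, Real.log (1 + Real.exp (-sᵢ * (mᵢ + bᵢ) + vᵢ / 2)). -/

import Mathlib

open MeasureTheory ProbabilityTheory

lemma integrable_log_one_add {Ω : Type*} [MeasurableSpace Ω] {μ : Measure Ω} {f : Ω → ℝ}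
    (hf : Integrable f μ) (hf0 : ∀ x, 0 ≤ f x) :
    Integrable (fun x => Real.log (1 + f x)) μ := by
  refine hf.mono (hf.aemeasurable.const_add 1).log.aestronglyMeasurable (.of_forall fun x => ?_)
  rw [Real.norm_of_nonneg (Real.log_nonneg (by linarith [hf0 x])), Real.norm_of_nonneg (hf0 x)]
  linarith [Real.log_le_sub_one_of_pos (show 0 < 1 + f x by linarith [hf0 x])]

lemma integral_log_one_add_le {Ω : Type*} [MeasurableSpace Ω] {μ : Measure Ω}
    [IsProbabilityMeasure μ] {f : Ω → ℝ} (hf : Integrable f μ) (hf0 : ∀ x, 0 ≤ f x) :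
    ∫ x, Real.log (1 + f x) ∂μ ≤ Real.log (1 + ∫ x, f x ∂μ) := by
  have hsub : Set.Ici (1 : ℝ) ⊆ Set.Ioi 0 := Set.Ici_subset_Ioi.2 one_pos
  have h := (strictConcaveOn_log_Ioi.concaveOn.subset hsub (convex_Ici 1)).le_map_integral
    (Real.continuousOn_log.mono fun x hx => (hsub hx).ne') isClosed_Ici
    (.of_forall fun x => le_add_of_nonneg_right (hf0 x))
    ((integrable_const (1 : ℝ)).add hf) (integrable_log_one_add hf hf0)
  simpa [integral_add (integrable_const (1 : ℝ)) hf] using h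

lemma integrable_exp_mul_add_gaussianReal (m : ℝ) (v : NNReal) (t b : ℝ) :
    Integrable (fun x => Real.exp (t * (x + b))) (gaussianReal m v) := by
  simp_rw [mul_add, Real.exp_add]
  exact (integrable_exp_mul_gaussianReal t).mul_const _

lemma integral_exp_mul_add_gaussianReal (m : ℝ) (v : NNReal) (t b : ℝ) :
    ∫ x, Real.exp (t * (x + b)) ∂gaussianReal m v =
      Real.exp (t * (m + b) + v * t ^ 2 / 2) := by
  have h := congrFun (mgf_id_gaussianReal (μ := m) (v := v)) t
  simp only [mgf, id] at h
  simp_rw [mul_add, Real.exp_add, integral_mul_const, h, ← Real.exp_add]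
  ring_nf

/-- The paper's Eq.(2): the expectation of the total binary cross-entropy loss over
independently Gaussian-sampled augmented classifier scores `x i ~ N(m i, v i)` is upper
bounded by a vanilla BCE loss with fixed additive inter-label margins `v i / 2`. -/
theorem pi_gaussian_bce_bound {ι : Type*} [Fintype ι] [Nonempty ι]
    (m b : ι → ℝ) (v : ι → NNReal) (s : ι → ℝ) (hs : ∀ i, s i = -1 ∨ s i = 1) :
    ∫ x : ι → ℝ, (∑ i, Real.log (1 + Real.exp (-s i * (x i + b i))))
        ∂(Measure.pi fun i => gaussianReal (m i) (v i)) ≤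
      ∑ i, Real.log (1 + Real.exp (-s i * (m i + b i) + (v i : ℝ) / 2)) := by
  have hexp (i : ι) := integrable_exp_mul_add_gaussianReal (m i) (v i) (-s i) (b i)
  have hlog (i : ι) := integrable_log_one_add (hexp i) fun x => (Real.exp_pos _).le
  have hpi (i : ι) : Integrable (fun x : ι → ℝ => Real.log (1 + Real.exp (-s i * (x i + b i))))
      (Measure.pi fun i => gaussianReal (m i) (v i)) :=
    integrable_comp_eval (μ := fun i => gaussianReal (m i) (v i)) (hlog i)
  rw [integral_finsetSum _ fun i _ => hpi i]
  refine Finset.sum_le_sum fun i _ => ?_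
  have hsq : (-s i) ^ 2 = 1 := by rcases hs i with h | h <;> simp [h]
  have h := integral_log_one_add_le (hexp i) fun x => (Real.exp_pos _).le
  rw [integral_exp_mul_add_gaussianReal, hsq, mul_one] at h
  exact (integral_comp_eval (μ := fun i => gaussianReal (m i) (v i))
    (hlog i).aestronglyMeasurable).trans_le h
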